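/- (Cell entropy inequality for the implicit method.) Let u, h : ℤ^d → ℝ be absolutely summable sequences such that u solves one implicit step with data h. Then for every k ∈ ℝ, every r ∈ (Δx/2, 1] and every α ∈ ℤ^d, all sums below converge absolutely and |u_α − k| ≤ |h_α − k| + Δt Σ_{β∈ℤ^d} G^{α,r}_β |A(u_β) − A(k)| + Δt · sgn(u_α − k) · Σ_{β∈ℤ^d} G^α_{β,r} A(u_β), where sgn(t) = 1 for t > 0, sgn(t) = −1 for t < 0, and sgn(0) = 0. -/

import Mathlib

open MeasureTheory Set

noncomputable section

abbrev Ed (d : ℕ) := EuclideanSpace ℝ (Fin d)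

def cell (d : ℕ) (dx : ℝ) (α : Fin d → ℤ) : Set (Ed d) :=
  {x | ∀ i, dx * (α i : ℝ) < x i ∧ x i < dx * (α i : ℝ) + dx}

def ind (d : ℕ) (S : Set (Ed d)) : Ed d → ℝ :=
  S.indicator fun _ => 1

def gam (d : ℕ) (dx : ℝ) (μ : Measure (Ed d)) (l : Fin d) : ℝ :=
  - ∫ z in {z : Ed d | dx / 2 < ‖z‖ ∧ ‖z‖ ≤ 1}, z l ∂μ

def Dup (d : ℕ) (dx : ℝ) (μ : Measure (Ed d)) (l : Fin d) (φ : Ed d → ℝ) (x : Ed d) : ℝ :=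
  if 0 < gam d dx μ l then (φ (x + EuclideanSpace.single l dx) - φ x) / dx
  else (φ x - φ (x - EuclideanSpace.single l dx)) / dx

def Glow (d : ℕ) (dx : ℝ) (μ : Measure (Ed d)) (α β : Fin d → ℤ) : ℝ :=
  (dx ^ d)⁻¹ *
    ∫ x in cell d dx α, ∫ z in {z : Ed d | dx / 2 < ‖z‖},
      (ind d (cell d dx β) (x + z) - ind d (cell d dx β) x) ∂μ

def Gup (d : ℕ) (dx : ℝ) (μ : Measure (Ed d)) (α β : Fin d → ℤ) : ℝ :=
  (dx ^ d)⁻¹ *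
    ∑ l : Fin d, gam d dx μ l * ∫ x in cell d dx α, Dup d dx μ l (ind d (cell d dx β)) x

def Gw (d : ℕ) (dx : ℝ) (μ : Measure (Ed d)) (α β : Fin d → ℤ) : ℝ :=
  Glow d dx μ α β + Gup d dx μ α β

def GsplitLow (d : ℕ) (dx r : ℝ) (μ : Measure (Ed d)) (α β : Fin d → ℤ) : ℝ :=
  (dx ^ d)⁻¹ *
    ∫ x in cell d dx α, ∫ z in {z : Ed d | dx / 2 < ‖z‖ ∧ ‖z‖ ≤ r},
      (ind d (cell d dx β) (x + z) - ind d (cell d dx β) x) ∂μ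

def GsplitHigh (d : ℕ) (dx r : ℝ) (μ : Measure (Ed d)) (α β : Fin d → ℤ) : ℝ :=
  (dx ^ d)⁻¹ *
      ∫ x in cell d dx α, ∫ z in {z : Ed d | r < ‖z‖},
        (ind d (cell d dx β) (x + z) - ind d (cell d dx β) x) ∂μ
    + Gup d dx μ α β

def Aok (A : ℝ → ℝ) (LA : ℝ) : Prop :=
  Monotone A ∧ (∀ a b : ℝ, |A a - A b| ≤ LA * |a - b|) ∧ A 0 = 0

def SolvesImplicitStep (d : ℕ) (dx : ℝ) (μ : Measure (Ed d)) (A : ℝ → ℝ) (dt : ℝ)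
    (u h : (Fin d → ℤ) → ℝ) : Prop :=
  ∀ α, Summable (fun β => Gw d dx μ α β * A (u β)) ∧
    u α - dt * ∑' β, Gw d dx μ α β * A (u β) = h α

def Fractional (d : ℕ) (μ : Measure (Ed d)) (lam clam : ℝ) : Prop :=
  ∀ B : Set (Ed d), MeasurableSet B → B ⊆ {z : Ed d | 0 < ‖z‖ ∧ ‖z‖ < 1} →
    μ B ≤ ∫⁻ z in B, ENNReal.ofReal (clam * ‖z‖ ^ (-(d : ℝ) - lam))

def Lhat (d : ℕ) (dx : ℝ) (μ : Measure (Ed d)) (w : Ed d → ℝ) (x : Ed d) : ℝ :=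
  (∫ z in {z : Ed d | dx / 2 < ‖z‖}, (w (x + z) - w x) ∂μ) +
    ∑ l : Fin d, gam d dx μ l * Dup d dx μ l w x

def Ubar (d : ℕ) (dx : ℝ) (U : (Fin d → ℤ) → ℝ) (x : Ed d) : ℝ :=
  ∑' α : Fin d → ℤ, U α * ind d (cell d dx α) x

def cellAvg (d : ℕ) (dx : ℝ) (w : Ed d → ℝ) (x : Ed d) : ℝ :=
  ∑' α : Fin d → ℤ, Set.indicator (cell d dx α)
    (fun _ => (dx ^ d)⁻¹ * ∫ y in cell d dx α, w y) x



lemma isOpen_cell (d : ℕ) (dx : ℝ) (α : Fin d → ℤ) : IsOpen (cell d dx α) := by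
  simp only [cell, ofPred_forall, ofPred_and]
  exact isOpen_iInter_of_finite fun i =>
    (isOpen_lt (by fun_prop) (by fun_prop)).inter (isOpen_lt (by fun_prop) (by fun_prop))

lemma measurableSet_cell (d : ℕ) (dx : ℝ) (α : Fin d → ℤ) : MeasurableSet (cell d dx α) :=
  (isOpen_cell d dx α).measurableSet

lemma measurable_ind_cell (d : ℕ) (dx : ℝ) (α : Fin d → ℤ) :
    Measurable (ind d (cell d dx α)) :=
  measurable_const.indicator (measurableSet_cell d dx α)

lemma ind_nonneg (d : ℕ) (S : Set (Ed d)) (x : Ed d) : 0 ≤ ind d S x :=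
  indicator_nonneg (fun _ _ => zero_le_one) x

lemma ind_le_one (d : ℕ) (S : Set (Ed d)) (x : Ed d) : ind d S x ≤ 1 :=
  indicator_le' (fun _ _ => le_rfl) (fun _ _ => zero_le_one) x

lemma volume_cell (d : ℕ) (dx : ℝ) (α : Fin d → ℤ) :
    volume (cell d dx α) = ENNReal.ofReal dx ^ d := by
  have hpre : cell d dx α = (fun x : Ed d => x.ofLp) ⁻¹'
      univ.pi fun i => Ioo (dx * (α i : ℝ)) (dx * (α i : ℝ) + dx) := by
    ext x
    simp [cell]
  rw [hpre, (PiLp.volume_preserving_ofLp (Fin d)).measure_preimage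
    (MeasurableSet.univ_pi fun _ => measurableSet_Ioo).nullMeasurableSet, Real.volume_pi_Ioo]
  simp

lemma pairwise_disjoint_cell (d : ℕ) {dx : ℝ} (hdx : 0 < dx) :
    Pairwise (Function.onFun Disjoint (cell d dx)) := by
  intro α β hαβ
  refine disjoint_left.2 fun x hα hβ => hαβ (funext fun i => ?_)
  obtain ⟨h1, h2⟩ := hα i
  obtain ⟨h3, h4⟩ := hβ i
  have h5 : (α i : ℝ) < β i + 1 := by nlinarith
  have h6 : (β i : ℝ) < α i + 1 := by nlinarith
  norm_cast at h5 h6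
  omega

lemma volume_compl_iUnion_cell (d : ℕ) {dx : ℝ} (hdx : 0 < dx) :
    volume (⋃ α, cell d dx α)ᶜ = 0 := by
  have hsub : (⋃ α, cell d dx α)ᶜ ⊆
      ⋃ i : Fin d, ⋃ n : ℤ, (fun x : Ed d => x.ofLp) ⁻¹' {y | y i = dx * n} := by
    intro x hx
    by_contra hne
    simp only [mem_iUnion, mem_preimage, mem_ofPred_eq, not_exists] at hne
    refine hx (mem_iUnion.2 ⟨fun i => ⌊x i / dx⌋, fun i => ⟨?_, ?_⟩⟩)
    · refine lt_of_le_of_ne ?_ (Ne.symm (hne i _))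
      have := Int.floor_le (x i / dx)
      rwa [le_div_iff₀ hdx, mul_comm] at this
    · have := Int.lt_floor_add_one (x i / dx)
      rw [div_lt_iff₀ hdx] at this
      linarith
  refine measure_mono_null hsub (measure_iUnion_null fun i => measure_iUnion_null fun n => ?_)
  rw [(PiLp.volume_preserving_ofLp (Fin d)).measure_preimage
    (measurableSet_eq_fun (by fun_prop) (by fun_prop)).nullMeasurableSet]
  exact Measure.pi_hyperplane _ i _

/-- The cells carry the whole mass of a finite measure not charging the grid lines. -/
lemma hasSum_measureReal_preimage_cell {X : Type*} [MeasurableSpace X] (m : Measure X)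
    [IsFiniteMeasure m] (d : ℕ) {dx : ℝ} (hdx : 0 < dx) {T : X → Ed d} (hT : Measurable T)
    (hnull : m (T ⁻¹' (⋃ α, cell d dx α)ᶜ) = 0) :
    HasSum (fun β => m.real (T ⁻¹' cell d dx β)) (m.real univ) := by
  have hsum : ∑' β, m (T ⁻¹' cell d dx β) = m univ := by
    rw [← measure_iUnion (fun a b hab => (pairwise_disjoint_cell d hdx hab).preimage T)
      fun β => hT (measurableSet_cell d dx β), ← preimage_iUnion]
    refine measure_congr (ae_eq_univ.2 ?_)
    rwa [← preimage_compl]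
  have := ENNReal.hasSum_toReal (hsum.trans_ne (measure_ne_top m univ))
  rwa [← ENNReal.tsum_toReal_eq (fun β => measure_ne_top m _), hsum] at this

section JumpWeight

variable (d : ℕ) (dx : ℝ) (α β : Fin d → ℤ) (ν : Measure (Ed d)) [IsFiniteMeasure ν]

instance isFiniteMeasure_restrict_cell : IsFiniteMeasure (volume.restrict (cell d dx α)) :=
  isFiniteMeasure_restrict.2 (by simp [volume_cell])

lemma integrable_ind_cell_comp {X : Type*} [MeasurableSpace X] (m : Measure X)
    [IsFiniteMeasure m] {T : X → Ed d} (hT : Measurable T) :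
    Integrable (fun p => ind d (cell d dx β) (T p)) m := by
  refine Integrable.of_bound ((measurable_ind_cell d dx β).comp hT).aestronglyMeasurable 1
    (Filter.Eventually.of_forall fun p => ?_)
  rw [Real.norm_of_nonneg (ind_nonneg _ _ _)]
  exact ind_le_one _ _ _

lemma integral_ind_cell_comp {X : Type*} [MeasurableSpace X] (m : Measure X)
    {T : X → Ed d} (hT : Measurable T) :
    ∫ p, ind d (cell d dx β) (T p) ∂m = m.real (T ⁻¹' cell d dx β) :=
  integral_indicator_one (hT (measurableSet_cell d dx β))

lemma integrable_jump :
    Integrable (fun p : Ed d × Ed d => ind d (cell d dx β) (p.1 + p.2) - ind d (cell d dx β) p.1)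
      ((volume.restrict (cell d dx α)).prod ν) :=
  (integrable_ind_cell_comp d dx β _ (measurable_fst.add measurable_snd)).sub
    (integrable_ind_cell_comp d dx β _ measurable_fst)

lemma hasSum_jump (hdx : 0 < dx) :
    HasSum (fun β => ∫ x in cell d dx α, ∫ z,
      (ind d (cell d dx β) (x + z) - ind d (cell d dx β) x) ∂ν) 0 := by
  set m := (volume.restrict (cell d dx α)).prod ν with hm
  have hN : MeasurableSet (⋃ γ, cell d dx γ)ᶜ :=
    (MeasurableSet.iUnion fun γ => measurableSet_cell d dx γ).compl
  have hT : Measurable fun p : Ed d × Ed d => p.1 + p.2 := measurable_fst.add measurable_snd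
  have key : ∀ z : Ed d, volume.restrict (cell d dx α)
      ((fun x => x + z) ⁻¹' (⋃ γ, cell d dx γ)ᶜ) = 0 := fun z =>
    Measure.absolutelyContinuous_of_le Measure.restrict_le_self
      (by rw [measure_preimage_add_right, volume_compl_iUnion_cell d hdx])
  have h1 : m ((fun p : Ed d × Ed d => p.1 + p.2) ⁻¹' (⋃ γ, cell d dx γ)ᶜ) = 0 := by
    rw [hm, Measure.prod_apply_symm (hT hN)]
    exact (lintegral_congr key).trans lintegral_zero
  have h2 : m ((fun p : Ed d × Ed d => p.1) ⁻¹' (⋃ γ, cell d dx γ)ᶜ) = 0 := by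
    rw [hm, Measure.prod_apply_symm (measurable_fst hN)]
    have h0 := key 0
    simp only [add_zero] at h0
    exact (lintegral_congr fun _ => h0).trans lintegral_zero
  have hsum := (hasSum_measureReal_preimage_cell m d hdx hT h1).sub
    (hasSum_measureReal_preimage_cell m d hdx measurable_fst h2)
  rw [sub_self] at hsum
  refine (congrArg (HasSum · 0) (funext fun β => ?_)).mpr hsum
  rw [← integral_ind_cell_comp d dx β m hT, ← integral_ind_cell_comp d dx β m measurable_fst,
    ← integral_sub (integrable_ind_cell_comp d dx β m hT)
      (integrable_ind_cell_comp d dx β m measurable_fst)]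
  exact (integral_prod _ (integrable_jump d dx α β ν)).symm

end JumpWeight

lemma jump_nonneg (d : ℕ) {dx : ℝ} {α β : Fin d → ℤ} (ν : Measure (Ed d))
    (hdx : 0 < dx) (hβ : β ≠ α) :
    0 ≤ ∫ x in cell d dx α, ∫ z,
      (ind d (cell d dx β) (x + z) - ind d (cell d dx β) x) ∂ν := by
  refine setIntegral_nonneg (measurableSet_cell d dx α) fun x hx => integral_nonneg fun z => ?_
  have h0 : ind d (cell d dx β) x = 0 :=
    indicator_of_notMem (disjoint_left.1 (pairwise_disjoint_cell d hdx hβ.symm) hx) _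
  simpa [h0] using ind_nonneg _ _ _

lemma measure_norm_gt_lt_top {d : ℕ} {μ : Measure (Ed d)}
    (hμ : ∫⁻ z, ENNReal.ofReal (min (‖z‖ ^ 2) 1) ∂μ < ⊤) {ρ : ℝ} (hρ : 0 < ρ) :
    μ {z | ρ < ‖z‖} < ⊤ := by
  have hpos : 0 < min (ρ ^ 2) 1 := by positivity
  refine (measure_mono fun z (hz : ρ < ‖z‖) => ?_).trans_lt
    (meas_ge_le_lintegral_div (f := fun z : Ed d => ENNReal.ofReal (min (‖z‖ ^ 2) 1))
      (by fun_prop) (ENNReal.ofReal_pos.2 hpos).ne' ENNReal.ofReal_ne_top |>.trans_lt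
      (ENNReal.div_lt_top hμ.ne (ENNReal.ofReal_pos.2 hpos).ne'))
  exact ENNReal.ofReal_le_ofReal (min_le_min_right _ (by gcongr))

lemma isFiniteMeasure_restrict_annulus {d : ℕ} {μ : Measure (Ed d)}
    (hμ : ∫⁻ z, ENNReal.ofReal (min (‖z‖ ^ 2) 1) ∂μ < ⊤) {ρ : ℝ} (hρ : 0 < ρ) (r : ℝ) :
    IsFiniteMeasure (μ.restrict {z | ρ < ‖z‖ ∧ ‖z‖ ≤ r}) :=
  isFiniteMeasure_restrict.2 ((measure_mono fun _ hz => hz.1).trans_lt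
    (measure_norm_gt_lt_top hμ hρ)).ne

lemma Gw_eq_split {d : ℕ} {dx r : ℝ} {μ : Measure (Ed d)} (hdx : 0 < dx) (hr : dx / 2 < r)
    (hμ : ∫⁻ z, ENNReal.ofReal (min (‖z‖ ^ 2) 1) ∂μ < ⊤) (α β : Fin d → ℤ) :
    Gw d dx μ α β = GsplitLow d dx r μ α β + GsplitHigh d dx r μ α β := by
  have hS : {z : Ed d | dx / 2 < ‖z‖} =
      {z : Ed d | dx / 2 < ‖z‖ ∧ ‖z‖ ≤ r} ∪ {z : Ed d | r < ‖z‖} := by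
    ext z
    simp only [mem_ofPred_eq, mem_union]
    grind
  have hdisj : Disjoint {z : Ed d | dx / 2 < ‖z‖ ∧ ‖z‖ ≤ r} {z : Ed d | r < ‖z‖} :=
    disjoint_left.2 fun z hz hz' => not_lt.2 hz.2 hz'
  have hmeas : MeasurableSet {z : Ed d | r < ‖z‖} := measurableSet_lt (by fun_prop) (by fun_prop)
  have := isFiniteMeasure_restrict_annulus hμ (half_pos hdx) r
  have := isFiniteMeasure_restrict.2
    (measure_norm_gt_lt_top hμ ((half_pos hdx).trans hr)).ne
  have hint : ∀ (ν : Measure (Ed d)) [IsFiniteMeasure ν] (x : Ed d), Integrable (fun z =>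
      ind d (cell d dx β) (x + z) - ind d (cell d dx β) x) ν := fun ν _ x =>
    (integrable_ind_cell_comp d dx β ν (measurable_const_add x)).sub (integrable_const _)
  have hsplit : ∀ x : Ed d, ∫ z in {z : Ed d | dx / 2 < ‖z‖},
        (ind d (cell d dx β) (x + z) - ind d (cell d dx β) x) ∂μ =
      ∫ z in {z : Ed d | dx / 2 < ‖z‖ ∧ ‖z‖ ≤ r},
        (ind d (cell d dx β) (x + z) - ind d (cell d dx β) x) ∂μ +
      ∫ z in {z : Ed d | r < ‖z‖},
        (ind d (cell d dx β) (x + z) - ind d (cell d dx β) x) ∂μ := fun x => by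
    rw [hS, setIntegral_union hdisj hmeas (hint _ x) (hint _ x)]
  rw [Gw, Glow, GsplitLow, GsplitHigh]
  simp only [hsplit]
  rw [integral_add (integrable_jump d dx α β _).integral_prod_left
    (integrable_jump d dx α β _).integral_prod_left,
    integral_add (integrable_jump d dx α β _).integral_prod_left (integrable_const _),
    setIntegral_const, Measure.real, volume_cell, ENNReal.toReal_pow,
    ENNReal.toReal_ofReal hdx.le, smul_eq_mul]
  field_simp
  ring

lemma hasSum_GsplitLow {d : ℕ} {dx : ℝ} {μ : Measure (Ed d)} (hdx : 0 < dx)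
    (hμ : ∫⁻ z, ENNReal.ofReal (min (‖z‖ ^ 2) 1) ∂μ < ⊤) (r : ℝ) (α : Fin d → ℤ) :
    HasSum (fun β => GsplitLow d dx r μ α β) 0 := by
  have := isFiniteMeasure_restrict_annulus hμ (half_pos hdx) r
  simpa [GsplitLow] using (hasSum_jump d dx α
    (μ.restrict {z : Ed d | dx / 2 < ‖z‖ ∧ ‖z‖ ≤ r}) hdx).mul_left (dx ^ d)⁻¹

lemma GsplitLow_nonneg {d : ℕ} {dx : ℝ} (μ : Measure (Ed d)) (hdx : 0 < dx) (r : ℝ)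
    {α β : Fin d → ℤ} (hβ : β ≠ α) : 0 ≤ GsplitLow d dx r μ α β :=
  mul_nonneg (by positivity) (jump_nonneg d _ hdx hβ)

lemma sign_mul_sub_eq_abs {A : ℝ → ℝ} (hA : Monotone A) {a k : ℝ} (h : a ≠ k) :
    Real.sign (a - k) * (A a - A k) = |A a - A k| := by
  rcases h.lt_or_gt with h | h
  · rw [Real.sign_of_neg (sub_neg.2 h), abs_of_nonpos (sub_nonpos.2 (hA h.le))]
    ring
  · rw [Real.sign_of_pos (sub_pos.2 h), abs_of_nonneg (sub_nonneg.2 (hA h.le)), one_mul]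

lemma abs_sign_le_one (t : ℝ) : |Real.sign t| ≤ 1 := by
  rcases Real.sign_apply_eq t with h | h | h <;> simp [h]

theorem stmt9 (d : ℕ) (hd : 1 ≤ d) (dx : ℝ) (hdx0 : 0 < dx) (hdx1 : dx < 1)
    (μ : Measure (Ed d)) (hμ0 : μ {0} = 0)
    (hμfin : ∫⁻ z, ENNReal.ofReal (min (‖z‖ ^ 2) 1) ∂μ < ⊤)
    (A : ℝ → ℝ) (LA : ℝ) (hA : Aok A LA) (dt : ℝ) (hdt : 0 < dt)
    (u h : (Fin d → ℤ) → ℝ)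
    (hu : Summable fun α => |u α|) (hh : Summable fun α => |h α|)
    (hstep : SolvesImplicitStep d dx μ A dt u h) :
    ∀ (k r : ℝ), dx / 2 < r → r ≤ 1 → ∀ α : Fin d → ℤ,
      Summable (fun β : Fin d → ℤ => GsplitLow d dx r μ α β * |A (u β) - A k|) ∧
      Summable (fun β : Fin d → ℤ => GsplitHigh d dx r μ α β * A (u β)) ∧
      |u α - k| ≤ |h α - k|
        + dt * ∑' β : Fin d → ℤ, GsplitLow d dx r μ α β * |A (u β) - A k|
        + dt * Real.sign (u α - k) * ∑' β : Fin d → ℤ, GsplitHigh d dx r μ α β * A (u β) := by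
  intro k r hr _ α
  obtain ⟨hmono, hlip, hA0⟩ := hA
  set L := fun β => GsplitLow d dx r μ α β with hL
  have hL0 : HasSum L 0 := hasSum_GsplitLow hdx0 hμfin r α
  obtain ⟨hG, hsol⟩ := hstep α
  have hAu : ∀ β, |A (u β)| ≤ |LA| * ∑' γ, |u γ| := fun β => by
    have h1 := hlip (u β) 0
    rw [hA0, sub_zero, sub_zero] at h1
    have h2 : |u β| ≤ ∑' γ, |u γ| := hu.le_tsum β fun _ _ => abs_nonneg _
    calc |A (u β)| ≤ LA * |u β| := h1
      _ ≤ |LA| * |u β| := by gcongr; exact le_abs_self LA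
      _ ≤ _ := by gcongr
  have hsum_bdd : ∀ (f : (Fin d → ℤ) → ℝ) (C : ℝ), (∀ β, |f β| ≤ C) →
      Summable fun β => L β * f β := fun f C hf =>
    (hL0.summable.abs.mul_right C).of_norm_bounded fun β => by
      rw [Real.norm_eq_abs, abs_mul]
      exact mul_le_mul_of_nonneg_left (hf β) (abs_nonneg _)
  have hLA : Summable fun β => L β * A (u β) := hsum_bdd _ _ hAu
  have hLabs : Summable fun β => L β * |A (u β) - A k| :=
    hsum_bdd _ (|LA| * ∑' γ, |u γ| + |A k|) fun β => by
      rw [abs_abs]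
      exact (abs_sub _ _).trans (by gcongr; exact hAu β)
  have hH : (fun β => GsplitHigh d dx r μ α β * A (u β)) =
      fun β => Gw d dx μ α β * A (u β) - L β * A (u β) := funext fun β => by
    rw [Gw_eq_split hdx0 hr hμfin]
    ring
  refine ⟨hLabs, hH ▸ hG.sub hLA, ?_⟩
  rw [hH, hG.tsum_sub hLA]
  have hLdiff : HasSum (fun β => L β * (A (u β) - A k)) (∑' β, L β * A (u β)) := by
    simpa [mul_sub] using hLA.hasSum.sub (hL0.mul_right (A k))
  set s := Real.sign (u α - k) with hs
  have hle : s * ∑' β, L β * A (u β) ≤ ∑' β, L β * |A (u β) - A k| := by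
    refine hasSum_le (fun β => ?_) (hLdiff.mul_left s) hLabs.hasSum
    by_cases hβ : β = α
    · subst hβ
      by_cases huk : u β = k
      · simp [huk]
      · rw [← sign_mul_sub_eq_abs hmono huk]
        exact (mul_left_comm _ _ _).le
    · rw [mul_left_comm]
      refine mul_le_mul_of_nonneg_left ?_ (GsplitLow_nonneg μ hdx0 r hβ)
      calc s * (A (u β) - A k) ≤ |s| * |A (u β) - A k| := (le_abs_self _).trans (abs_mul _ _).le
        _ ≤ |A (u β) - A k| := mul_le_of_le_one_left (abs_nonneg _) (abs_sign_le_one _)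
  have hsu : |u α - k| = s * (u α - k) := by
    by_cases huk : u α = k
    · simp [huk]
    · exact (sign_mul_sub_eq_abs monotone_id huk).symm
  have hsh : s * (h α - k) ≤ |h α - k| :=
    (le_abs_self _).trans ((abs_mul _ _).trans_le
      (mul_le_of_le_one_left (abs_nonneg _) (abs_sign_le_one _)))
  rw [hsu]
  have := mul_le_mul_of_nonneg_left hle hdt.le
  rw [← hsol] at hsh ⊢
  linear_combination hsh + this
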